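/- Let n ≥ 3, φ(t) = ln((n−2)/t) + ln(1 + (ln t)/(2t)), and w(t) = ln(2t + φ(t)) + η(t) for t large, where η(t) = O(1/t²) as t → ∞. Then lim_{t→∞} t · e^{−2t} · exp( exp(w(t)) ) = n − 2. -/

import Mathlib

/-- Multiplicative form of the double exponential of a perturbed logarithm. -/
theorem mul_exp_exp_log_add {c t u e : ℝ} (hc : 0 < c) (ht : 0 < t) (hu : 0 < u)
    (hA : 0 < 2 * t + (Real.log (c / t) + Real.log u)) :
    t * (Real.exp (-2 * t) *
        Real.exp (Real.exp (Real.log (2 * t + (Real.log (c / t) + Real.log u)) + e))) =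
      c * u * Real.exp ((2 * t + (Real.log (c / t) + Real.log u)) * (Real.exp e - 1)) := by
  rw [Real.exp_add, Real.exp_log hA]
  set A := 2 * t + (Real.log (c / t) + Real.log u) with hAdef
  have hsplit : Real.exp (-2 * t) * Real.exp (A * Real.exp e) =
      Real.exp (Real.log (c / t)) * Real.exp (Real.log u) * Real.exp (A * (Real.exp e - 1)) := by
    simp only [← Real.exp_add]
    congr 1
    linear_combination -hAdef
  rw [hsplit, Real.exp_log (div_pos hc ht), Real.exp_log hu]
  field_simp

open Filter Topology in
theorem tendsto_log_div_self : Tendsto (fun t : ℝ => Real.log t / t) atTop (𝓝 0) :=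
  Real.isLittleO_log_id_atTop.tendsto_div_nhds_zero

open Filter Topology in
theorem tendsto_one_add_log_div_two_mul :
    Tendsto (fun t : ℝ => 1 + Real.log t / (2 * t)) atTop (𝓝 1) := by
  have h := (tendsto_log_div_self.const_mul (1 / 2)).const_add 1
  simp only [mul_zero, add_zero] at h
  refine h.congr fun t => ?_
  rw [div_mul_div_comm, one_mul]

open Filter Topology in
theorem tendsto_two_mul_add_log_div {c : ℝ} (hc : 0 < c) :
    Tendsto (fun t : ℝ => (2 * t +
      (Real.log (c / t) + Real.log (1 + Real.log t / (2 * t)))) / t) atTop (𝓝 2) := by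
  have hconst : Tendsto (fun t : ℝ => Real.log c / t) atTop (𝓝 0) :=
    tendsto_const_nhds.div_atTop tendsto_id
  have hlog : Tendsto (fun t : ℝ => Real.log (1 + Real.log t / (2 * t)) / t) atTop (𝓝 0) :=
    (tendsto_one_add_log_div_two_mul.log one_ne_zero).div_atTop tendsto_id
  have h := (((hconst.sub tendsto_log_div_self).add hlog).const_add 2)
  simp only [sub_zero, add_zero] at h
  refine h.congr' ?_
  filter_upwards [eventually_gt_atTop 0] with t ht
  rw [Real.log_div hc.ne' ht.ne']
  field_simp

open Filter Topology in
theorem tendsto_mul_exp_sub_one {η : ℝ → ℝ} {C T : ℝ} (hη : ∀ t > T, |η t| ≤ C / t ^ 2) :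
    Tendsto (fun t : ℝ => t * (Real.exp (η t) - 1)) atTop (𝓝 0) := by
  have hsq : Tendsto (fun t : ℝ => C / t ^ 2) atTop (𝓝 0) :=
    tendsto_const_nhds.div_atTop (tendsto_pow_atTop two_ne_zero)
  have hbound : Tendsto (fun t : ℝ => 2 * C / t) atTop (𝓝 0) :=
    tendsto_const_nhds.div_atTop tendsto_id
  refine squeeze_zero_norm' ?_ hbound
  filter_upwards [eventually_gt_atTop T, eventually_gt_atTop 0,
    hsq.eventually_le_const one_pos] with t hT ht h1
  have hle := Real.abs_exp_sub_one_le ((hη t hT).trans h1)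
  rw [Real.norm_eq_abs, abs_mul, abs_of_pos ht]
  calc t * |Real.exp (η t) - 1| ≤ t * (2 * (C / t ^ 2)) := by
        gcongr
        exact hle.trans (by gcongr; exact hη t hT)
    _ = 2 * C / t := by field_simp


/-- if `w(t) = ln(2t + φ(t)) + η(t)` with `η(t) = O(1/t²)`, where
`φ(t) = ln((n-2)/t) + ln(1 + (ln t)/(2t))`, then
`lim_{t→∞} t e^{-2t} exp( e^{w(t)} ) = n - 2`. -/
theorem limit_for_y_star (n : ℕ) (hn : 3 ≤ n) (T : ℝ) (w η : ℝ → ℝ)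
    (hw : ∀ t > T, w t = Real.log (2 * t +
        (Real.log (((n : ℝ) - 2) / t) + Real.log (1 + Real.log t / (2 * t)))) + η t)
    (hη : ∃ C > (0 : ℝ), ∃ T' > (0 : ℝ), ∀ t > T', |η t| ≤ C / t ^ 2) :
    Filter.Tendsto
      (fun t : ℝ => t * (Real.exp (-2 * t) * Real.exp (Real.exp (w t))))
      Filter.atTop (nhds ((n : ℝ) - 2)) := by
  obtain ⟨C, -, T', -, hη⟩ := hη
  have hc : (0 : ℝ) < (n : ℝ) - 2 := by
    have : (3 : ℝ) ≤ n := by exact_mod_cast hn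
    linarith
  have hA := tendsto_two_mul_add_log_div hc
  have hexp := (hA.mul (tendsto_mul_exp_sub_one hη)).rexp
  have h := (tendsto_one_add_log_div_two_mul.const_mul ((n : ℝ) - 2)).mul hexp
  simp only [mul_zero, Real.exp_zero, mul_one] at h
  refine h.congr' ?_
  filter_upwards [Filter.eventually_gt_atTop T, Filter.eventually_gt_atTop 0,
    hA.eventually_const_lt two_pos,
    tendsto_one_add_log_div_two_mul.eventually_const_lt one_pos] with t hT ht hAt hu
  rw [hw t hT, mul_exp_exp_log_add hc ht hu ((div_pos_iff_of_pos_right ht).1 hAt),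
    ← mul_assoc (_ / t) t, div_mul_cancel₀ _ ht.ne']
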